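/- Let P be a finite set of points in ℝ², let K ⊆ ℝ² be a convex set, and let Q be a convex polygon (the convex hull of a finite set of points) satisfying P ∩ K ⊆ Q ⊆ K. Then there exists a convex polygon Q' such that: (a) P ∩ K ⊆ Q' ⊆ Q; (b) the number of vertices (extreme points) of Q' is at most twice the number of vertices of Q; and (c) every edge of Q' (i.e., every one-dimensional face of Q', a maximal segment contained in its boundary) lies on a line passing through two distinct points of P. -/

import Mathlib

/-- `E` is an edge of the set `Q`: `E` is a segment with distinct endpoints contained
in the frontier of `Q`, and it is maximal among such segments. -/
def IsEdgeOf (Q E : Set (EuclideanSpace ℝ (Fin 2))) : Prop :=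
  (∃ p q : EuclideanSpace ℝ (Fin 2), p ≠ q ∧ E = segment ℝ p q) ∧ E ⊆ frontier Q ∧
    ∀ E' : Set (EuclideanSpace ℝ (Fin 2)),
      (∃ p q : EuclideanSpace ℝ (Fin 2), p ≠ q ∧ E' = segment ℝ p q) →
      E' ⊆ frontier Q → E ⊆ E' → E = E'

open scoped Topology Pointwise

/-- The Euclidean plane. -/
abbrev Plane := EuclideanSpace ℝ (Fin 2)

/-- The intersection of the half-planes `⟪g, x - c⟫ ≤ 1`, for `g ∈ G`; for `c = 0` this is the
polar of `G`. -/
def polarAt (c : Plane) (G : Finset Plane) : Set Plane :=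
  {x | ∀ g ∈ G, inner ℝ g (x - c) ≤ 1}

theorem convex_polarAt (c : Plane) (G : Finset Plane) : Convex ℝ (polarAt c G) := by
  intro x hx y hy a b ha hb hab g hg
  have h : a • x + b • y - c = a • (x - c) + b • (y - c) := by
    have : c = (a + b) • c := by rw [hab, one_smul]
    rw [smul_sub, smul_sub]
    nth_rewrite 1 [this]
    rw [add_smul]
    abel
  rw [h, inner_add_right, inner_smul_right, inner_smul_right]
  nlinarith [mul_le_mul_of_nonneg_left (hx g hg) ha, mul_le_mul_of_nonneg_left (hy g hg) hb]

theorem isClosed_polarAt (c : Plane) (G : Finset Plane) : IsClosed (polarAt c G) := by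
  have : polarAt c G = ⋂ g ∈ G, {x | inner ℝ g (x - c) ≤ 1} := by
    ext x
    simp [polarAt]
  rw [this]
  exact isClosed_biInter fun g _ => isClosed_le (by fun_prop) continuous_const

theorem exists_inner_eq_one_of_mem_frontier_polarAt {c : Plane} {G : Finset Plane} {x : Plane}
    (hx : x ∈ frontier (polarAt c G)) : ∃ g ∈ G, inner ℝ g (x - c) = 1 := by
  by_contra! h
  have hxm : x ∈ polarAt c G := (isClosed_polarAt c G).frontier_subset hx
  refine hx.2 (mem_interior_iff_mem_nhds.2 ?_)
  have h1 : ∀ᶠ y in 𝓝 x, ∀ g ∈ G, inner ℝ g (y - c) < 1 := by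
    rw [Filter.eventually_all_finset]
    intro g hg
    have hcont : Continuous fun y : Plane => inner ℝ g (y - c) := by fun_prop
    exact hcont.continuousAt.eventually_lt_const (lt_of_le_of_ne (hxm g hg) (h g hg))
  filter_upwards [h1] with y hy g hg using (hy g hg).le

theorem exists_ne_zero_inner_eq_zero (g : Plane) : ∃ d : Plane, d ≠ 0 ∧ inner ℝ g d = 0 := by
  by_cases hg : g = 0
  · exact ⟨!₂[1, 0], fun h => by simpa using congrArg (fun v : Plane => v 0) h, by simp [hg]⟩
  · refine ⟨!₂[-g 1, g 0], fun h => hg ?_, ?_⟩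
    · have h0 := congrArg (fun v : Plane => v 0) h
      have h1 := congrArg (fun v : Plane => v 1) h
      ext i
      fin_cases i <;> simp_all
    · simp [PiLp.inner_apply, Fin.sum_univ_two]
      ring

theorem collinear_setOf_inner_eq {g : Plane} (hg : g ≠ 0) (r : ℝ) :
    Collinear ℝ {x : Plane | inner ℝ g x = r} := by
  rcases Set.eq_empty_or_nonempty {x : Plane | inner ℝ g x = r} with h | ⟨p, hp⟩
  · rw [h]
    exact collinear_empty ℝ Plane
  rw [collinear_iff_of_mem hp]
  have hpos : 0 < g 0 ^ 2 + g 1 ^ 2 := by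
    rcases eq_or_ne (g 0) 0 with h0 | h0
    · rcases eq_or_ne (g 1) 0 with h1 | h1
      · refine absurd ?_ hg
        ext i
        fin_cases i <;> simp_all
      · positivity
    · positivity
  refine ⟨!₂[-g 1, g 0], fun q hq =>
    ⟨(-g 1 * (q 0 - p 0) + g 0 * (q 1 - p 1)) / (g 0 ^ 2 + g 1 ^ 2), ?_⟩⟩
  simp only [Set.mem_ofPred_eq, PiLp.inner_apply, Fin.sum_univ_two, RCLike.inner_apply,
    conj_trivial] at hp hq
  ext i
  fin_cases i
  · simp
    field_simp
    linear_combination g 0 * (hq - hp)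
  · simp
    field_simp
    linear_combination g 1 * (hq - hp)

theorem collinear_of_inner_sub_eq_one {g c : Plane} {s : Set Plane}
    (h : ∀ x ∈ s, inner ℝ g (x - c) = 1) : Collinear ℝ s := by
  rcases s.eq_empty_or_nonempty with rfl | ⟨x, hx⟩
  · exact collinear_empty ℝ Plane
  have hg : g ≠ 0 := by
    rintro rfl
    simpa using h x hx
  refine (collinear_setOf_inner_eq hg (1 + inner ℝ g c)).subset fun y hy => ?_
  have := h y hy
  rw [inner_sub_right] at this
  simp only [Set.mem_ofPred_eq]
  linarith

theorem eq_or_eq_of_wbtw_of_mem_extremePoints {X : Set Plane} {x y z : Plane} (hx : x ∈ X)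
    (hy : y ∈ Set.extremePoints ℝ X) (hz : z ∈ X) (h : Wbtw ℝ x y z) : x = y ∨ z = y := by
  by_contra! hne
  have := mem_openSegment_of_ne_left_right hne.1 hne.2 (mem_segment_iff_wbtw.2 h)
  exact hne.1 ((mem_extremePoints.1 hy).2 x hx z hz this).1

theorem Collinear.card_le_two_of_subset_extremePoints {X : Set Plane} {T : Finset Plane}
    (hT : (T : Set Plane) ⊆ Set.extremePoints ℝ X) (hcol : Collinear ℝ (T : Set Plane)) :
    T.card ≤ 2 := by
  by_contra! h
  obtain ⟨a, ha, b, hb, c, hc, hab, hac, hbc⟩ := Finset.two_lt_card.1 h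
  have hsub : ({a, b, c} : Set Plane) ⊆ (T : Set Plane) := by
    rintro x (rfl | rfl | rfl) <;> assumption
  have ea := hT ha
  have eb := hT hb
  have ec := hT hc
  rcases (hcol.subset hsub).wbtw_or_wbtw_or_wbtw with w | w | w
  · rcases eq_or_eq_of_wbtw_of_mem_extremePoints ea.1 eb ec.1 w with e | e
    · exact hab e
    · exact hbc e.symm
  · rcases eq_or_eq_of_wbtw_of_mem_extremePoints eb.1 ec ea.1 w with e | e
    · exact hbc e
    · exact hac e
  · rcases eq_or_eq_of_wbtw_of_mem_extremePoints ec.1 ea eb.1 w with e | e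
    · exact hac e.symm
    · exact hab e.symm

/-- At every extreme point of an intersection of half-planes, two of the inequalities are
equalities. -/
theorem exists_pair_inner_eq_one_of_mem_extremePoints {c : Plane} {G : Finset Plane} {x : Plane}
    (hx : x ∈ Set.extremePoints ℝ (polarAt c G)) :
    ∃ s ∈ G, ∃ t ∈ G, s ≠ t ∧ inner ℝ s (x - c) = 1 ∧ inner ℝ t (x - c) = 1 := by
  by_contra! H
  obtain ⟨d, hd0, hd⟩ : ∃ d : Plane, d ≠ 0 ∧ ∀ g ∈ G, inner ℝ g (x - c) = 1 →
      inner ℝ g d = 0 := by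
    by_cases hex : ∃ s ∈ G, inner ℝ s (x - c) = 1
    · obtain ⟨s, hs, hs1⟩ := hex
      obtain ⟨d, hd0, hd⟩ := exists_ne_zero_inner_eq_zero s
      refine ⟨d, hd0, fun g hg hg1 => ?_⟩
      by_cases hsg : s = g
      · rwa [← hsg]
      · exact absurd hg1 (H s hs g hg hsg hs1)
    · obtain ⟨d, hd0, -⟩ := exists_ne_zero_inner_eq_zero 0
      exact ⟨d, hd0, fun g hg hg1 => absurd ⟨g, hg, hg1⟩ hex⟩
  have hev : ∀ v : Plane, (∀ g ∈ G, inner ℝ g (x - c) = 1 → inner ℝ g v = 0) →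
      ∀ᶠ e in 𝓝[>] (0 : ℝ), x + e • v ∈ polarAt c G := by
    intro v hv
    have : ∀ᶠ e in 𝓝 (0 : ℝ), ∀ g ∈ G, inner ℝ g (x + e • v - c) ≤ 1 := by
      rw [Filter.eventually_all_finset]
      intro g hg
      by_cases h1 : inner ℝ g (x - c) = 1
      · refine Filter.Eventually.of_forall fun e => ?_
        rw [add_sub_right_comm, inner_add_right, inner_smul_right, hv g hg h1, h1]
        simp
      · have hcont : Continuous fun e : ℝ => inner ℝ g (x + e • v - c) := by fun_prop
        have hlt : inner ℝ g (x + (0 : ℝ) • v - c) < 1 := by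
          rw [zero_smul, add_zero]
          exact lt_of_le_of_ne (hx.1 g hg) h1
        filter_upwards [hcont.continuousAt.eventually_lt_const hlt] with e he using he.le
    exact this.filter_mono nhdsWithin_le_nhds
  have hneg := hev (-d) fun g hg h => by rw [inner_neg_right, hd g hg h, neg_zero]
  obtain ⟨e, he1, he2, he0⟩ :=
    ((hev d hd).and (hneg.and (eventually_mem_nhdsWithin (a := (0 : ℝ)) (s := Set.Ioi 0)))).exists
  have hmem : x ∈ openSegment ℝ (x + e • d) (x + e • -d) := by
    refine ⟨1 / 2, 1 / 2, by norm_num, by norm_num, by norm_num, ?_⟩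
    module
  have h := ((mem_extremePoints.1 hx).2 _ he1 _ he2 hmem).1
  rw [add_eq_left, smul_eq_zero] at h
  rcases h with h | h
  · exact (ne_of_gt he0) h
  · exact hd0 h

theorem card_le_of_subset_extremePoints_polarAt {c : Plane} {G T : Finset Plane}
    (hT : (T : Set Plane) ⊆ Set.extremePoints ℝ (polarAt c G)) : T.card ≤ G.card := by
  classical
  have h := Finset.card_mul_le_card_mul (s := T) (t := G) (m := 2) (n := 2)
    (fun x g => inner ℝ g (x - c) = 1) ?_ ?_
  · omega
  · intro x hx
    obtain ⟨s, hs, t, ht, hst, h1, h2⟩ :=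
      exists_pair_inner_eq_one_of_mem_extremePoints (hT hx)
    refine Finset.one_lt_card.2 ⟨s, ?_, t, ?_, hst⟩ <;> simp [Finset.bipartiteAbove, *]
  · intro g hg
    refine Collinear.card_le_two_of_subset_extremePoints (X := polarAt c G) ?_
      (collinear_of_inner_sub_eq_one (g := g) (c := c) ?_)
    · intro x hx
      simp only [Finset.bipartiteBelow, Finset.coe_filter, Set.mem_ofPred_eq] at hx
      exact hT hx.1
    · intro x hx
      simp only [Finset.bipartiteBelow, Finset.coe_filter, Set.mem_ofPred_eq] at hx
      exact hx.2

theorem finite_extremePoints_polarAt (c : Plane) (G : Finset Plane) :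
    (Set.extremePoints ℝ (polarAt c G)).Finite := by
  by_contra h
  obtain ⟨T, hT, hcard⟩ := Set.Infinite.exists_subset_card_eq h (G.card + 1)
  have := card_le_of_subset_extremePoints_polarAt hT
  omega

theorem ncard_extremePoints_polarAt_le (c : Plane) (G : Finset Plane) :
    (Set.extremePoints ℝ (polarAt c G)).ncard ≤ G.card := by
  rw [Set.ncard_eq_toFinset_card _ (finite_extremePoints_polarAt c G)]
  exact card_le_of_subset_extremePoints_polarAt (c := c) (by simp)

theorem eq_convexHull_of_finite_extremePoints {X : Set Plane} (hX : IsCompact X)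
    (hconv : Convex ℝ X) (hfin : (Set.extremePoints ℝ X).Finite) :
    X = convexHull ℝ (Set.extremePoints ℝ X) := by
  have h := closure_convexHull_extremePoints hX hconv
  rw [(hfin.isClosed_convexHull ℝ).closure_eq] at h
  exact h.symm

theorem inner_le_one_of_mem_convexHull {W : Finset Plane} {x y : Plane}
    (hy : ∀ w ∈ W, inner ℝ w y ≤ 1) (hx : x ∈ convexHull ℝ (W : Set Plane)) :
    inner ℝ x y ≤ 1 := by
  have hconv : Convex ℝ {z : Plane | inner ℝ z y ≤ 1} := by
    intro p hp q hq a b ha hb hab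
    simp only [Set.mem_ofPred_eq] at hp hq ⊢
    rw [inner_add_left, real_inner_smul_left, real_inner_smul_left]
    nlinarith [mul_le_mul_of_nonneg_left hp ha, mul_le_mul_of_nonneg_left hq hb]
  exact convexHull_min (s := (W : Set Plane)) (t := {z : Plane | inner ℝ z y ≤ 1})
    (fun w hw => hy w hw) hconv hx

theorem isCompact_polarAt_zero {W : Finset Plane}
    (h0 : (0 : Plane) ∈ interior (convexHull ℝ (W : Set Plane))) : IsCompact (polarAt 0 W) := by
  obtain ⟨r, hr, hball⟩ := Metric.mem_nhds_iff.1 (mem_interior_iff_mem_nhds.1 h0)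
  refine Metric.isCompact_of_isClosed_isBounded (isClosed_polarAt 0 W)
    ((Metric.isBounded_closedBall (x := (0 : Plane)) (r := 2 / r)).subset fun y hy => ?_)
  rw [mem_closedBall_zero_iff]
  rcases eq_or_ne y 0 with rfl | hy0
  · rw [norm_zero]
    positivity
  have hn : 0 < ‖y‖ := norm_pos_iff.2 hy0
  have hmem : (r / 2 / ‖y‖) • y ∈ convexHull ℝ (W : Set Plane) := by
    apply hball
    rw [mem_ball_zero_iff, norm_smul, Real.norm_of_nonneg (by positivity)]
    field_simp
    linarith
  have h := inner_le_one_of_mem_convexHull (y := y)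
    (fun w hw => by simpa using hy w hw) hmem
  rw [real_inner_smul_left, real_inner_self_eq_norm_sq] at h
  rw [le_div_iff₀ hr]
  field_simp at h
  linarith

theorem exists_mem_polarAt_zero_one_lt_inner {W : Finset Plane}
    (h0 : (0 : Plane) ∈ convexHull ℝ (W : Set Plane)) {x : Plane}
    (hx : x ∉ convexHull ℝ (W : Set Plane)) : ∃ y ∈ polarAt 0 W, 1 < inner ℝ x y := by
  obtain ⟨f, u, hfu, hux⟩ := geometric_hahn_banach_closed_point (convex_convexHull ℝ _)
    (W.finite_toSet.isClosed_convexHull ℝ) hx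
  have hu : 0 < u := by simpa using hfu 0 h0
  obtain ⟨y, hy⟩ : ∃ y : Plane, ∀ z, inner ℝ y z = f z :=
    ⟨(InnerProductSpace.toDual ℝ Plane).symm f, fun z =>
      InnerProductSpace.toDual_symm_apply⟩
  refine ⟨u⁻¹ • y, fun w hw => ?_, ?_⟩
  · rw [sub_zero, inner_smul_right, real_inner_comm, hy, inv_mul_le_iff₀ hu, mul_one]
    exact (hfu w (subset_convexHull ℝ _ hw)).le
  · rw [inner_smul_right, real_inner_comm, hy, lt_inv_mul_iff₀ hu, mul_one]
    exact hux

/-- A finite polygon with the origin in its interior is the intersection of the half-planes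
given by the extreme points of its polar. -/
theorem mem_convexHull_of_inner_extremePoints_polarAt_le {W : Finset Plane}
    (h0 : (0 : Plane) ∈ interior (convexHull ℝ (W : Set Plane))) {x : Plane}
    (hx : ∀ b ∈ Set.extremePoints ℝ (polarAt 0 W), inner ℝ b x ≤ 1) :
    x ∈ convexHull ℝ (W : Set Plane) := by
  by_contra hxn
  obtain ⟨y, hy, hxy⟩ := exists_mem_polarAt_zero_one_lt_inner (interior_subset h0) hxn
  have hfin := finite_extremePoints_polarAt 0 W
  rw [eq_convexHull_of_finite_extremePoints (isCompact_polarAt_zero h0) (convex_polarAt 0 W) hfin,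
    ← hfin.coe_toFinset] at hy
  have := inner_le_one_of_mem_convexHull (y := x) (fun w hw => hx w (by simpa using hw)) hy
  rw [real_inner_comm] at this
  linarith

/-- Carathéodory's theorem relative to the origin: a subconvex combination of vectors of the
plane is a subconvex combination of at most two of them. -/
theorem exists_subset_card_le_two_subconvex_combination (A : Finset Plane) (w : Plane → ℝ)
    (hw : ∀ a ∈ A, 0 ≤ w a) (hsum : ∑ a ∈ A, w a ≤ 1) :
    ∃ B ⊆ A, B.card ≤ 2 ∧ ∃ v : Plane → ℝ, (∀ a ∈ B, 0 ≤ v a) ∧ ∑ a ∈ B, v a ≤ 1 ∧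
      ∑ a ∈ B, v a • a = ∑ a ∈ A, w a • a := by
  classical
  induction A using Finset.strongInduction generalizing w with
  | H A ih =>
    by_cases hA : A.card ≤ 2
    · exact ⟨A, Finset.Subset.refl A, hA, w, hw, hsum, rfl⟩
    have hrank : Module.finrank ℝ Plane < A.card := by
      rw [finrank_euclideanSpace_fin]
      omega
    obtain ⟨f, hf0, hfs, a, ha, hfa⟩ : ∃ f : Plane → ℝ, ∑ e ∈ A, f e • e = 0 ∧
        0 ≤ ∑ e ∈ A, f e ∧ ∃ a ∈ A, f a ≠ 0 := by
      obtain ⟨f, hf, a, ha, hfa⟩ := Module.exists_nontrivial_relation_of_finrank_lt_card hrank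
      rcases le_total 0 (∑ e ∈ A, f e) with h | h
      · exact ⟨f, hf, h, a, ha, hfa⟩
      · refine ⟨fun e => -f e, ?_, ?_, a, ha, neg_ne_zero.2 hfa⟩
        · simp [hf]
        · simpa using h
    obtain ⟨p, hp, hfp⟩ : ∃ p ∈ A, 0 < f p := by
      by_contra! hneg
      have hz := (Finset.sum_eq_zero_iff_of_nonpos hneg).1
        (le_antisymm (Finset.sum_nonpos hneg) hfs)
      exact hfa (hz a ha)
    obtain ⟨i, hi, hmin⟩ := Finset.exists_min_image (A.filter fun e => 0 < f e)
      (fun e => w e / f e) ⟨p, Finset.mem_filter.2 ⟨hp, hfp⟩⟩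
    obtain ⟨hiA, hfi⟩ := Finset.mem_filter.1 hi
    set t := w i / f i with ht
    have ht0 : 0 ≤ t := div_nonneg (hw i hiA) hfi.le
    have hvi : w i - t * f i = 0 := by
      rw [ht]
      field_simp
      ring
    have hv : ∀ e ∈ A, 0 ≤ w e - t * f e := by
      intro e he
      rcases le_or_gt (f e) 0 with hfe | hfe
      · nlinarith [hw e he, mul_nonneg ht0 (neg_nonneg.2 hfe)]
      · have := hmin e (Finset.mem_filter.2 ⟨he, hfe⟩)
        rw [le_div_iff₀ hfe] at this
        linarith
    obtain ⟨B, hBA, hB, v, hv0, hv1, hvs⟩ := ih (A.erase i) (Finset.erase_ssubset hiA)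
      (fun e => w e - t * f e) (fun e he => hv e (Finset.mem_of_mem_erase he)) (by
        rw [Finset.sum_erase (f := fun e => w e - t * f e) A hvi, Finset.sum_sub_distrib, ← Finset.mul_sum]
        nlinarith [mul_nonneg ht0 hfs])
    refine ⟨B, hBA.trans (Finset.erase_subset i A), hB, v, hv0, hv1, ?_⟩
    rw [hvs, Finset.sum_erase _ (by rw [hvi, zero_smul])]
    simp_rw [sub_smul, mul_smul]
    rw [Finset.sum_sub_distrib, ← Finset.smul_sum, hf0, smul_zero, sub_zero]

theorem inner_le_one_of_subconvex_combination {B : Finset Plane} {v : Plane → ℝ} {x : Plane}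
    (hv : ∀ a ∈ B, 0 ≤ v a) (hsum : ∑ a ∈ B, v a ≤ 1) (hx : ∀ a ∈ B, inner ℝ a x ≤ 1) :
    inner ℝ (∑ a ∈ B, v a • a) x ≤ 1 := by
  rw [sum_inner]
  refine le_trans (Finset.sum_le_sum fun a ha => ?_) hsum
  rw [real_inner_smul_left]
  exact mul_le_of_le_one_right (hv a ha) (hx a ha)

/-- Between the convex hulls of `S` and `W` one can insert an intersection of at most
`2 * W.card` half-planes each of whose boundary lines contains two points of `S`. -/
theorem exists_polarAt_zero_between {S W : Finset Plane}
    (h0 : (0 : Plane) ∈ interior (convexHull ℝ (S : Set Plane)))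
    (hSW : (S : Set Plane) ⊆ convexHull ℝ (W : Set Plane)) :
    ∃ G : Finset Plane, G.card ≤ 2 * W.card ∧ (S : Set Plane) ⊆ polarAt 0 G ∧
      polarAt 0 G ⊆ convexHull ℝ (W : Set Plane) ∧
      ∀ g ∈ G, ∃ s ∈ S, ∃ t ∈ S, s ≠ t ∧ inner ℝ g s = 1 ∧ inner ℝ g t = 1 := by
  classical
  have h0W : (0 : Plane) ∈ interior (convexHull ℝ (W : Set Plane)) :=
    interior_mono (convexHull_min hSW (convex_convexHull ℝ _)) h0
  set B := (finite_extremePoints_polarAt 0 W).toFinset with hB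
  set A := (finite_extremePoints_polarAt 0 S).toFinset with hA
  have hBA : ∀ b ∈ B, ∃ D ⊆ A, D.card ≤ 2 ∧ ∃ v : Plane → ℝ, (∀ a ∈ D, 0 ≤ v a) ∧
      ∑ a ∈ D, v a ≤ 1 ∧ ∑ a ∈ D, v a • a = b := by
    intro b hb
    have hbW : b ∈ polarAt 0 W := by
      rw [hB, Set.Finite.mem_toFinset] at hb
      exact hb.1
    have hbS : b ∈ polarAt 0 S := fun s hs => by
      simpa using inner_le_one_of_mem_convexHull (y := b)
        (fun w hw => by simpa using hbW w hw) (hSW hs)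
    rw [eq_convexHull_of_finite_extremePoints (isCompact_polarAt_zero h0) (convex_polarAt 0 S)
      (finite_extremePoints_polarAt 0 S), ← (finite_extremePoints_polarAt 0 S).coe_toFinset,
      Finset.mem_convexHull'] at hbS
    obtain ⟨w, hw0, hw1, rfl⟩ := hbS
    exact exists_subset_card_le_two_subconvex_combination A w hw0 hw1.le
  choose! D hDA hD2 v hv0 hv1 hvs using hBA
  have hGA : B.biUnion D ⊆ A := Finset.biUnion_subset.2 hDA
  refine ⟨B.biUnion D, ?_, ?_, ?_, ?_⟩
  · have h1 := Finset.card_biUnion_le_card_mul B D 2 hD2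
    have h2 : B.card ≤ W.card := card_le_of_subset_extremePoints_polarAt (c := 0) (by simp [hB])
    omega
  · intro s hs g hg
    have hgA := hGA hg
    rw [hA, Set.Finite.mem_toFinset] at hgA
    rw [sub_zero, real_inner_comm]
    simpa using hgA.1 s hs
  · intro x hx
    refine mem_convexHull_of_inner_extremePoints_polarAt_le h0W fun b hb => ?_
    have hbB : b ∈ B := by rwa [hB, Set.Finite.mem_toFinset]
    rw [← hvs b hbB]
    refine inner_le_one_of_subconvex_combination (hv0 b hbB) (hv1 b hbB) fun a ha => ?_
    simpa using hx a (Finset.mem_biUnion.2 ⟨b, hbB, ha⟩)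
  · intro g hg
    have hgA := hGA hg
    rw [hA, Set.Finite.mem_toFinset] at hgA
    obtain ⟨s, hs, t, ht, hst, h1, h2⟩ := exists_pair_inner_eq_one_of_mem_extremePoints hgA
    rw [sub_zero, real_inner_comm] at h1 h2
    exact ⟨s, hs, t, ht, hst, h1, h2⟩

theorem coe_image_sub_eq_vadd (c : Plane) (T : Finset Plane) :
    ((T.image fun x => x - c : Finset Plane) : Set Plane) = -c +ᵥ (T : Set Plane) := by
  ext x
  simp only [Finset.coe_image, Set.mem_image, Set.mem_vadd_set, vadd_eq_add, neg_add_eq_sub]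

theorem exists_polarAt_between {S W : Finset Plane} {c : Plane}
    (hc : c ∈ interior (convexHull ℝ (S : Set Plane)))
    (hSW : (S : Set Plane) ⊆ convexHull ℝ (W : Set Plane)) :
    ∃ G : Finset Plane, G.card ≤ 2 * W.card ∧ (S : Set Plane) ⊆ polarAt c G ∧
      polarAt c G ⊆ convexHull ℝ (W : Set Plane) ∧
      ∀ g ∈ G, ∃ s ∈ S, ∃ t ∈ S, s ≠ t ∧ inner ℝ g (s - c) = 1 ∧ inner ℝ g (t - c) = 1 := by
  classical
  have hS := coe_image_sub_eq_vadd c S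
  have hW := coe_image_sub_eq_vadd c W
  obtain ⟨G, hcard, hSG, hGW, hG⟩ := exists_polarAt_zero_between
    (S := S.image fun x => x - c) (W := W.image fun x => x - c)
    (by
      rw [hS, convexHull_vadd, interior_vadd, Set.mem_vadd_set]
      exact ⟨c, hc, by simp⟩)
    (by
      rw [hS, hW, convexHull_vadd]
      exact Set.vadd_set_mono hSW)
  refine ⟨G, hcard.trans (Nat.mul_le_mul_left 2 Finset.card_image_le), ?_, ?_, ?_⟩
  · intro s hs g hg
    simpa using hSG (Finset.mem_coe.2 (Finset.mem_image_of_mem (fun x => x - c) hs)) g hg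
  · intro x hx
    have hmem : x - c ∈ polarAt 0 G := fun g hg => by simpa using hx g hg
    have h := hGW hmem
    rw [hW, convexHull_vadd, Set.mem_vadd_set] at h
    obtain ⟨y, hy, hyx⟩ := h
    rw [vadd_eq_add, neg_add_eq_sub, sub_left_inj] at hyx
    rwa [← hyx]
  · intro g hg
    obtain ⟨s, hs, t, ht, hst, h1, h2⟩ := hG g hg
    obtain ⟨s', hs', rfl⟩ := Finset.mem_image.1 hs
    obtain ⟨t', ht', rfl⟩ := Finset.mem_image.1 ht
    exact ⟨s', hs', t', ht', fun h => hst (by rw [h]), h1, h2⟩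

/-- A segment in the boundary of an intersection of half-planes lies on the boundary line of one
of them. -/
theorem exists_inner_eq_one_of_segment_subset_frontier {c p q : Plane} {G : Finset Plane}
    (h : segment ℝ p q ⊆ frontier (polarAt c G)) :
    ∃ g ∈ G, ∀ x ∈ segment ℝ p q, inner ℝ g (x - c) = 1 := by
  have hcl := (isClosed_polarAt c G).frontier_subset
  obtain ⟨g, hg, hm⟩ := exists_inner_eq_one_of_mem_frontier_polarAt (h (midpoint_mem_segment p q))
  have hp := hcl (h (left_mem_segment ℝ p q)) g hg
  have hq := hcl (h (right_mem_segment ℝ p q)) g hg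
  have hmid : midpoint ℝ p q - c = (1 / 2 : ℝ) • (p - c) + (1 / 2 : ℝ) • (q - c) := by
    rw [midpoint_eq_smul_add, invOf_eq_inv]
    module
  rw [hmid, inner_add_right, inner_smul_right, inner_smul_right] at hm
  have hp1 : inner ℝ g (p - c) = 1 := by linarith
  have hq1 : inner ℝ g (q - c) = 1 := by linarith
  refine ⟨g, hg, ?_⟩
  rintro x ⟨a, b, -, -, hab, rfl⟩
  have hx : a • p + b • q - c = a • (p - c) + b • (q - c) := by
    have : b = 1 - a := by linarith
    subst this
    module
  rw [hx, inner_add_right, inner_smul_right, inner_smul_right, hp1, hq1]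
  linarith

theorem collinear_of_interior_convexHull_eq_empty {S : Set Plane}
    (h : interior (convexHull ℝ S) = ∅) : Collinear ℝ S := by
  rcases S.eq_empty_or_nonempty with rfl | hne
  · exact collinear_empty ℝ Plane
  have hspan : vectorSpan ℝ S ≠ ⊤ := by
    rw [Ne, ← AffineSubspace.affineSpan_eq_top_iff_vectorSpan_eq_top_of_nonempty ℝ Plane Plane hne,
      ← interior_convexHull_nonempty_iff_affineSpan_eq_top, h]
    exact Set.not_nonempty_empty
  rw [collinear_iff_finrank_le_one]
  have := Submodule.finrank_lt hspan
  rw [finrank_euclideanSpace_fin] at this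
  omega

theorem exists_line_of_segment_subset_convexHull {S : Set Plane} (hS : Collinear ℝ S)
    {p q : Plane} (hpq : p ≠ q) (h : segment ℝ p q ⊆ convexHull ℝ S) :
    ∃ a ∈ S, ∃ b ∈ S, a ≠ b ∧ segment ℝ p q ⊆ (affineSpan ℝ {a, b} : Set Plane) := by
  rcases S.subsingleton_or_nontrivial with hsub | ⟨a, ha, b, hb, hab⟩
  · have hS' : Convex ℝ S := hsub.convex
    rw [hS'.convexHull_eq] at h
    exact absurd (hsub (h (left_mem_segment ℝ p q)) (h (right_mem_segment ℝ p q))) hpq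
  · refine ⟨a, ha, b, hb, hab, ?_⟩
    rw [hS.affineSpan_eq_of_ne ha hb hab]
    exact h.trans (convexHull_subset_affineSpan S)

theorem ncard_extremePoints_convexHull_le_two {S : Finset Plane}
    (hS : Collinear ℝ (S : Set Plane)) :
    (Set.extremePoints ℝ (convexHull ℝ (S : Set Plane))).ncard ≤ 2 := by
  have hsub : Set.extremePoints ℝ (convexHull ℝ (S : Set Plane)) ⊆ S :=
    extremePoints_convexHull_subset
  have hfin := S.finite_toSet.subset hsub
  rw [Set.ncard_eq_toFinset_card _ hfin]
  refine Collinear.card_le_two_of_subset_extremePoints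
    (X := convexHull ℝ (S : Set Plane)) (by simp) (hS.subset ?_)
  simpa using hsub

/-- Let `P ⊆ ℝ²` be finite, `K` convex, and `Q = conv(V)` a convex
polygon with `P ∩ K ⊆ Q ⊆ K`. Then there is a convex polygon `Q'` with
`P ∩ K ⊆ Q' ⊆ Q`, having at most twice as many vertices (extreme points) as `Q`,
all of whose edges lie on lines through two distinct points of `P`. -/
theorem stmt_4 (P : Set (EuclideanSpace ℝ (Fin 2))) (hP : P.Finite)
    (K : Set (EuclideanSpace ℝ (Fin 2))) (hK : Convex ℝ K)
    (V : Finset (EuclideanSpace ℝ (Fin 2))) (Q : Set (EuclideanSpace ℝ (Fin 2)))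
    (hQ : Q = convexHull ℝ (V : Set (EuclideanSpace ℝ (Fin 2))))
    (hPKQ : P ∩ K ⊆ Q) (hQK : Q ⊆ K) :
    ∃ (V' : Finset (EuclideanSpace ℝ (Fin 2))) (Q' : Set (EuclideanSpace ℝ (Fin 2))),
      Q' = convexHull ℝ (V' : Set (EuclideanSpace ℝ (Fin 2))) ∧
      P ∩ K ⊆ Q' ∧ Q' ⊆ Q ∧
      (Set.extremePoints ℝ Q').ncard ≤ 2 * (Set.extremePoints ℝ Q).ncard ∧
      ∀ E : Set (EuclideanSpace ℝ (Fin 2)), IsEdgeOf Q' E →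
        ∃ a ∈ P, ∃ b ∈ P, a ≠ b ∧
          E ⊆ (affineSpan ℝ {a, b} : Set (EuclideanSpace ℝ (Fin 2))) := by
  have hQconv : Convex ℝ Q := hQ ▸ convex_convexHull ℝ _
  have hQcomp : IsCompact Q := hQ ▸ V.finite_toSet.isCompact_convexHull ℝ
  have hQfin : (Set.extremePoints ℝ Q).Finite := by
    rw [hQ]
    exact V.finite_toSet.subset extremePoints_convexHull_subset
  obtain ⟨S, hS⟩ : ∃ S : Finset Plane, (S : Set Plane) = P ∩ K :=
    ⟨(hP.inter_of_left K).toFinset, by simp⟩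
  have hSP : ∀ s ∈ S, s ∈ P := fun s hs => (hS ▸ Finset.mem_coe.2 hs : s ∈ P ∩ K).1
  rw [← hS] at hPKQ ⊢
  rcases (interior (convexHull ℝ (S : Set Plane))).eq_empty_or_nonempty with hint | ⟨c, hc⟩
  · have hcol := collinear_of_interior_convexHull_eq_empty hint
    refine ⟨S, _, rfl, subset_convexHull ℝ _, convexHull_min hPKQ hQconv, ?_, ?_⟩
    · rcases (S : Set Plane).eq_empty_or_nonempty with he | hne
      · simp [he]
      · have hpos : 0 < (Set.extremePoints ℝ Q).ncard :=
          (Set.ncard_pos hQfin).2 (hQcomp.extremePoints_nonempty (hne.mono hPKQ))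
        have := ncard_extremePoints_convexHull_le_two hcol
        omega
    · rintro E ⟨⟨p, q, hpq, rfl⟩, hfr, -⟩
      obtain ⟨a, ha, b, hb, hab, hsub⟩ := exists_line_of_segment_subset_convexHull hcol hpq
        (hfr.trans (S.finite_toSet.isClosed_convexHull ℝ).frontier_subset)
      exact ⟨a, hSP a ha, b, hSP b hb, hab, hsub⟩
  · have hQW : Q = convexHull ℝ (hQfin.toFinset : Set Plane) := by
      rw [hQfin.coe_toFinset]
      exact eq_convexHull_of_finite_extremePoints hQcomp hQconv hQfin
    obtain ⟨G, hcard, hSG, hGQ, hG⟩ := exists_polarAt_between hc (hQW ▸ hPKQ)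
    rw [← hQW] at hGQ
    have hfin := finite_extremePoints_polarAt c G
    refine ⟨hfin.toFinset, polarAt c G, ?_, hSG, hGQ, ?_, ?_⟩
    · rw [hfin.coe_toFinset]
      exact eq_convexHull_of_finite_extremePoints
        (hQcomp.of_isClosed_subset (isClosed_polarAt c G) hGQ) (convex_polarAt c G) hfin
    · rw [Set.ncard_eq_toFinset_card _ hQfin]
      exact (ncard_extremePoints_polarAt_le c G).trans hcard
    · rintro E ⟨⟨p, q, -, rfl⟩, hfr, -⟩
      obtain ⟨g, hg, hgE⟩ := exists_inner_eq_one_of_segment_subset_frontier hfr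
      obtain ⟨s, hs, t, ht, hst, h1, h2⟩ := hG g hg
      refine ⟨s, hSP s hs, t, hSP t ht, hst, fun x hx => ?_⟩
      have hcol : Collinear ℝ ({s, t, x} : Set Plane) := by
        refine collinear_of_inner_sub_eq_one (g := g) (c := c) ?_
        rintro y (rfl | rfl | rfl)
        · exact h1
        · exact h2
        · exact hgE _ hx
      exact hcol.mem_affineSpan_of_mem_of_ne (by simp) (by simp) (by simp) hst
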